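/- Let Φ = {φ_j}_{j=1}^N be a self-similar system on ℝ^m satisfying the open set condition, with infinite attractor F and scaling vector r; set D := D_r, x_1 := sup{x > 0 : N_B(F,x) = 1}, and L(x) := N_B(F,x) − ∑_{j=1}^N N_B(F, r_j x). Then there exists ε > 0 such that for every s ∈ ℂ with Re(s) > D − ε, the integral E(s) := s·∫_{x_1}^∞ L(x) x^{−s−1} dx converges absolutely. -/

import Mathlib

open Filter Topology Metric MeasureTheory

/-- The box-counting function `N_B(A,x)`: the maximal number of pairwise disjoint closed
balls of radius `x⁻¹` whose centers lie in `A`. -/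
noncomputable def boxCount {m : ℕ} (A : Set (EuclideanSpace ℝ (Fin m))) (x : ℝ) : ℕ :=
  sSup {n : ℕ | ∃ c : Fin n → EuclideanSpace ℝ (Fin m), (∀ i, c i ∈ A) ∧
    Pairwise fun i j => Disjoint (closedBall (c i) x⁻¹) (closedBall (c j) x⁻¹)}

/-- `φ` is a contracting similarity with scaling ratio `ρ`. -/
def IsSimilarity {X : Type*} [MetricSpace X] (φ : X → X) (ρ : ℝ) : Prop :=
  ∀ x y, dist (φ x) (φ y) = ρ * dist x y

/-- The composition `φ_{w₁} ∘ ⋯ ∘ φ_{wₙ}` along a word `w`. -/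
def wordMap {ι X : Type*} (φ : ι → X → X) : List ι → X → X
  | [] => id
  | j :: w => φ j ∘ wordMap φ w

/-- The product `r_{w₁} ⋯ r_{wₙ}` along a word `w`. -/
def wordRatio {ι : Type*} (r : ι → ℝ) (w : List ι) : ℝ := (w.map r).prod

section Words

variable {ι X : Type*}

theorem wordMap_append (φ : ι → X → X) (a b : List ι) :
    wordMap φ (a ++ b) = wordMap φ a ∘ wordMap φ b := by
  induction a with
  | nil => rfl
  | cons j a ih => simp [wordMap, ih, Function.comp_assoc]

theorem wordRatio_append (r : ι → ℝ) (a b : List ι) :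
    wordRatio r (a ++ b) = wordRatio r a * wordRatio r b := by
  simp [wordRatio]

theorem wordRatio_cons (r : ι → ℝ) (j : ι) (b : List ι) :
    wordRatio r (j :: b) = r j * wordRatio r b := by
  simp [wordRatio]

theorem wordRatio_pos {r : ι → ℝ} (hr : ∀ j, r j ∈ Set.Ioo (0 : ℝ) 1) (w : List ι) :
    0 < wordRatio r w := by
  induction w with
  | nil => simp [wordRatio]
  | cons j w ih => rw [wordRatio_cons]; exact mul_pos (hr j).1 ih

theorem wordRatio_le_one {r : ι → ℝ} (hr : ∀ j, r j ∈ Set.Ioo (0 : ℝ) 1) (w : List ι) :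
    wordRatio r w ≤ 1 := by
  induction w with
  | nil => simp [wordRatio]
  | cons j w ih =>
    rw [wordRatio_cons]
    exact mul_le_one₀ (hr j).2.le (wordRatio_pos hr w).le ih

theorem wordMap_image_subset {φ : ι → X → X} {A : Set X} (h : ∀ j, φ j '' A ⊆ A)
    (w : List ι) : wordMap φ w '' A ⊆ A := by
  induction w with
  | nil => simp [wordMap]
  | cons j w ih =>
    rw [wordMap, Set.image_comp]
    exact (Set.image_mono ih).trans (h j)

theorem wordMap_cons_image_subset {φ : ι → X → X} {A : Set X} (h : ∀ j, φ j '' A ⊆ A)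
    (j : ι) (w : List ι) : wordMap φ (j :: w) '' A ⊆ φ j '' A := by
  rw [wordMap, Set.image_comp]
  exact Set.image_mono (wordMap_image_subset h w)

theorem wordMap_surjective {φ : ι → X → X} (h : ∀ j, Function.Surjective (φ j))
    (w : List ι) : Function.Surjective (wordMap φ w) := by
  induction w with
  | nil => exact Function.surjective_id
  | cons j w ih => exact (h j).comp ih

theorem isSimilarity_wordMap [MetricSpace X] {φ : ι → X → X} {r : ι → ℝ}
    (h : ∀ j, IsSimilarity (φ j) (r j)) (w : List ι) :
    IsSimilarity (wordMap φ w) (wordRatio r w) := by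
  induction w with
  | nil => intro x y; simp [wordMap, wordRatio]
  | cons j w ih =>
    intro x y
    rw [wordRatio_cons, wordMap, Function.comp_apply, Function.comp_apply, h, ih, mul_assoc]

theorem IsSimilarity.injective [MetricSpace X] {f : X → X} {ρ : ℝ}
    (h : IsSimilarity f ρ) (hρ : 0 < ρ) : Function.Injective f := by
  intro x y hxy
  have := h x y
  rw [hxy, dist_self] at this
  exact dist_eq_zero.1 ((mul_eq_zero.1 this.symm).resolve_left hρ.ne')

/-- Every point of the attractor lies in a cylinder set of any prescribed level. -/
theorem exists_mem_wordMap_image {φ : ι → X → X} {F : Set X} (hF : F = ⋃ j, φ j '' F) (n : ℕ) :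
    ∀ y ∈ F, ∃ w : Fin n → ι, y ∈ wordMap φ (List.ofFn w) '' F := by
  induction n with
  | zero => intro y hy; exact ⟨Fin.elim0, by simpa [wordMap] using hy⟩
  | succ n ih =>
    intro y hy
    rw [hF] at hy
    obtain ⟨j, z, hz, rfl⟩ := Set.mem_iUnion.1 hy
    obtain ⟨w, u, hu, rfl⟩ := ih z hz
    exact ⟨Fin.cons j w, u, hu, by simp [wordMap, List.ofFn_succ]⟩

/-- Every point of the attractor lies in a cylinder set of any prescribed size, up to the
smallest contraction ratio, whose word may begin with any letter the point allows. -/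
theorem exists_wordRatio_mem_Icc {φ : ι → X → X} {F : Set X} (hF : F = ⋃ j, φ j '' F)
    {r : ι → ℝ} {ρ θ : ℝ} (hρ : 0 < ρ) (hρr : ∀ j, ρ ≤ r j) (hθ : ∀ j, r j ≤ θ) (n : ℕ) :
    ∀ t : ℝ, t < 1 → θ ^ n ≤ t → ∀ (l : ι), ∀ y ∈ F, ∃ w, φ l y ∈ wordMap φ (l :: w) '' F ∧
      ρ * t ≤ wordRatio r (l :: w) ∧ wordRatio r (l :: w) ≤ t := by
  induction n with
  | zero => intro t ht ht'; simp at ht'; linarith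
  | succ n ih =>
    intro t ht htn l y hy
    have hl : 0 < r l := hρ.trans_le (hρr l)
    have ht0 : 0 < t := (pow_pos (hl.trans_le (hθ l)) _).trans_le htn
    by_cases hlt : r l ≤ t
    · refine ⟨[], ⟨y, hy, rfl⟩, ?_, ?_⟩
      · simp only [wordRatio, List.map_cons, List.map_nil, List.prod_cons, List.prod_nil, mul_one]
        nlinarith [hρr l]
      · simpa [wordRatio] using hlt
    · push Not at hlt
      rw [hF] at hy
      obtain ⟨j, z, hz, rfl⟩ := Set.mem_iUnion.1 hy
      obtain ⟨w, ⟨u, hu, hu'⟩, h1, h2⟩ := ih (t / r l) ((div_lt_one hl).2 hlt) (by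
        rw [le_div_iff₀ hl]
        refine le_trans ?_ htn
        rw [pow_succ]
        exact mul_le_mul_of_nonneg_left (hθ l) (pow_pos (hl.trans_le (hθ l)) _).le) j z hz
      refine ⟨j :: w, ⟨u, hu, ?_⟩, ?_, ?_⟩
      · rw [wordMap, Function.comp_apply, hu']
      · rw [wordRatio_cons, mul_comm (r l)]
        rwa [mul_div_assoc', div_le_iff₀ hl] at h1
      · rw [wordRatio_cons, mul_comm (r l)]
        rwa [le_div_iff₀ hl] at h2

end Words

section Packing

variable {E : Type*} [NormedAddCommGroup E] [NormedSpace ℝ E]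

theorem exists_card_le_of_separated [ProperSpace E] (C : ℝ) {c : ℝ} (hc : 0 < c) :
    ∃ M : ℕ, ∀ (ι : Type) (T : Finset ι) (f : ι → E) (p : E) (t : ℝ), 0 < t →
      (∀ i ∈ T, dist (f i) p ≤ C * t) →
      ((T : Set ι).Pairwise fun i j => c * t ≤ dist (f i) (f j)) → T.card ≤ M := by
  obtain ⟨u, -, hu, hcov⟩ :=
    (isCompact_closedBall (0 : E) C).finite_cover_balls (half_pos hc)
  refine ⟨hu.toFinset.card, fun ι T f p t ht hT hsep => ?_⟩
  have hmem : ∀ i ∈ T, ∃ z ∈ u, dist (t⁻¹ • (f i - p)) z < c / 2 := by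
    intro i hi
    have : t⁻¹ • (f i - p) ∈ closedBall (0 : E) C := by
      rw [mem_closedBall_zero_iff, norm_smul, Real.norm_of_nonneg (inv_nonneg.2 ht.le),
        ← dist_eq_norm, inv_mul_le_iff₀ ht, mul_comm]
      exact hT i hi
    simpa using hcov this
  choose! g hg hgd using hmem
  refine Finset.card_le_card_of_injOn g (fun i hi => by simpa using hg i hi) ?_
  intro i hi j hj hij
  by_contra hne
  have h1 := hsep hi hj hne
  have h2 : dist (t⁻¹ • (f i - p)) (t⁻¹ • (f j - p)) < c := by
    have := dist_triangle_right (t⁻¹ • (f i - p)) (t⁻¹ • (f j - p)) (g i)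
    have h3 := hgd i hi
    have h4 := hgd j hj
    rw [← hij] at h4
    linarith
  rw [dist_smul₀, dist_sub_right, Real.norm_of_nonneg (inv_nonneg.2 ht.le),
    inv_mul_lt_iff₀ ht] at h2
  linarith

end Packing

theorem IsSimilarity.surjective {m : ℕ}
    {f : EuclideanSpace ℝ (Fin m) → EuclideanSpace ℝ (Fin m)} {ρ : ℝ}
    (h : IsSimilarity f ρ) (hρ : 0 < ρ) : Function.Surjective f := by
  have hiso : Isometry fun x => ρ⁻¹ • f x := Isometry.of_dist_eq fun x y => by
    rw [dist_smul₀, h, Real.norm_of_nonneg (inv_nonneg.2 hρ.le), inv_mul_cancel_left₀ hρ.ne']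
  have hs : Function.Surjective
      (hiso.affineIsometryOfStrictConvexSpace.toAffineIsometryEquiv rfl) :=
    AffineIsometryEquiv.surjective _
  intro y
  obtain ⟨x, hx⟩ := hs (ρ⁻¹ • y)
  exact ⟨x, smul_right_injective _ (inv_ne_zero hρ.ne') (by simpa using hx)⟩

section BoxCount

variable {m : ℕ} {A : Set (EuclideanSpace ℝ (Fin m))} {x : ℝ}

theorem boxCount_set_eq (hx : 0 < x) :
    {n : ℕ | ∃ c : Fin n → EuclideanSpace ℝ (Fin m), (∀ i, c i ∈ A) ∧
      Pairwise fun i j => Disjoint (closedBall (c i) x⁻¹) (closedBall (c j) x⁻¹)} =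
    {n : ℕ | ∃ S : Finset (EuclideanSpace ℝ (Fin m)),
      (S : Set (EuclideanSpace ℝ (Fin m))) ⊆ A ∧
      ((S : Set (EuclideanSpace ℝ (Fin m))).Pairwise fun p q => 2 * x⁻¹ < dist p q) ∧
      S.card = n} := by
  have hx' : 0 < x⁻¹ := inv_pos.2 hx
  ext n
  simp only [Set.mem_ofPred_eq, disjoint_closedBall_closedBall_iff hx'.le hx'.le, ← two_mul]
  constructor
  · rintro ⟨c, hc, hp⟩
    have hinj : Function.Injective c := by
      intro i j hij
      by_contra hne
      have : 2 * x⁻¹ < dist (c i) (c j) := hp hne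
      rw [hij, dist_self] at this
      linarith
    refine ⟨Finset.univ.map ⟨c, hinj⟩, ?_, ?_, by simp⟩
    · intro y hy
      simp only [Finset.coe_map, Function.Embedding.coeFn_mk, Finset.coe_univ, Set.image_univ,
        Set.mem_range] at hy
      obtain ⟨i, rfl⟩ := hy
      exact hc i
    · intro p hp' q hq' hne
      simp only [Finset.coe_map, Function.Embedding.coeFn_mk, Finset.coe_univ, Set.image_univ,
        Set.mem_range] at hp' hq'
      obtain ⟨i, rfl⟩ := hp'
      obtain ⟨j, rfl⟩ := hq'
      exact hp fun hij => hne (by rw [hij])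
  · rintro ⟨S, hS, hp, rfl⟩
    refine ⟨fun i => (S.equivFin.symm i : EuclideanSpace ℝ (Fin m)),
      fun i => hS (S.equivFin.symm i).2, fun i j hij => ?_⟩
    exact hp (S.equivFin.symm i).2 (S.equivFin.symm j).2
      fun h => hij (S.equivFin.symm.injective (Subtype.ext h))

theorem bddAbove_card_separated (hA : IsCompact A) (hx : 0 < x) :
    BddAbove {n : ℕ | ∃ S : Finset (EuclideanSpace ℝ (Fin m)),
      (S : Set (EuclideanSpace ℝ (Fin m))) ⊆ A ∧
      ((S : Set (EuclideanSpace ℝ (Fin m))).Pairwise fun p q => 2 * x⁻¹ < dist p q) ∧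
      S.card = n} := by
  obtain ⟨R, hR⟩ := hA.isBounded.subset_closedBall (0 : EuclideanSpace ℝ (Fin m))
  obtain ⟨M, hM⟩ := exists_card_le_of_separated (E := EuclideanSpace ℝ (Fin m)) R
    (mul_pos two_pos (inv_pos.2 hx))
  refine ⟨M, ?_⟩
  rintro n ⟨S, hS, hp, rfl⟩
  refine hM _ S id 0 1 one_pos (fun i hi => by simpa using hR (hS hi)) fun i hi j hj hij => ?_
  simpa using (hp hi hj hij).le

theorem card_le_boxCount (hA : IsCompact A) (hx : 0 < x)
    {S : Finset (EuclideanSpace ℝ (Fin m))} (hS : (S : Set (EuclideanSpace ℝ (Fin m))) ⊆ A)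
    (hsep : (S : Set (EuclideanSpace ℝ (Fin m))).Pairwise fun p q => 2 * x⁻¹ < dist p q) :
    S.card ≤ boxCount A x := by
  rw [boxCount, boxCount_set_eq hx]
  exact le_csSup (bddAbove_card_separated hA hx) ⟨S, hS, hsep, rfl⟩

theorem exists_card_eq_boxCount (hA : IsCompact A) (hx : 0 < x) :
    ∃ S : Finset (EuclideanSpace ℝ (Fin m)),
      (S : Set (EuclideanSpace ℝ (Fin m))) ⊆ A ∧
      ((S : Set (EuclideanSpace ℝ (Fin m))).Pairwise fun p q => 2 * x⁻¹ < dist p q) ∧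
      S.card = boxCount A x := by
  rw [boxCount, boxCount_set_eq hx]
  exact Nat.sSup_mem (Set.nonempty_of_mem (x := 0) (Set.mem_ofPred_eq ▸ ⟨∅, by simp⟩))
    (bddAbove_card_separated hA hx)

theorem boxCount_monotoneOn (hA : IsCompact A) :
    MonotoneOn (boxCount A) (Set.Ioi 0) := by
  intro x hx y hy hxy
  obtain ⟨S, hS, hsep, hcard⟩ := exists_card_eq_boxCount hA hx
  rw [← hcard]
  refine card_le_boxCount hA hy hS fun p hp q hq hpq => lt_of_le_of_lt ?_ (hsep hp hq hpq)
  have := inv_anti₀ hx hxy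
  linarith

theorem sSup_boxCount_eq_one_pos (hA : IsCompact A) (hA' : A.Nontrivial) :
    0 < sSup {x : ℝ | 0 < x ∧ boxCount A x = 1} := by
  obtain ⟨p, hp, q, hq, hpq⟩ := hA'
  have hd : 0 < dist p q := dist_pos.2 hpq
  have hbdd : BddAbove {x : ℝ | 0 < x ∧ boxCount A x = 1} := by
    refine ⟨2 / dist p q, ?_⟩
    rintro x ⟨hx, hx1⟩
    by_contra! hlt
    have h2 : 2 * x⁻¹ < dist p q := by
      rw [← div_eq_mul_inv, div_lt_iff₀ hx]
      rwa [div_lt_iff₀ hd, mul_comm] at hlt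
    have h := card_le_boxCount hA hx (S := {p, q}) (by simp [Set.insert_subset_iff, hp, hq]) (by
      rw [Finset.coe_pair, Set.pairwise_pair]
      exact fun _ => ⟨h2, by rwa [dist_comm]⟩)
    rw [Finset.card_pair hpq, hx1] at h
    omega
  set x := (diam A)⁻¹ with hxdef
  have hdiam : 0 < diam A := hd.trans_le (dist_le_diam_of_mem hA.isBounded hp hq)
  have hx : 0 < x := inv_pos.2 hdiam
  refine hx.trans_le (le_csSup hbdd ⟨hx, ?_⟩)
  apply le_antisymm
  · obtain ⟨S, hS, hsep, hcard⟩ := exists_card_eq_boxCount hA hx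
    rw [← hcard, Finset.card_le_one]
    intro a ha b hb
    by_contra hab
    have h1 := hsep ha hb hab
    have h2 := dist_le_diam_of_mem hA.isBounded (hS ha) (hS hb)
    rw [hxdef, inv_inv] at h1
    linarith
  · simpa using card_le_boxCount hA hx (S := {p}) (by simpa using hp) (by simp)

end BoxCount

section SelfSimilar

variable {m N : ℕ} {φ : Fin N → EuclideanSpace ℝ (Fin m) → EuclideanSpace ℝ (Fin m)}
  {r : Fin N → ℝ} {V F : Set (EuclideanSpace ℝ (Fin m))}

theorem exists_ratio_bounds (hr : ∀ j, r j ∈ Set.Ioo (0 : ℝ) 1) :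
    ∃ ρ θ : ℝ, 0 < ρ ∧ 0 < θ ∧ θ < 1 ∧ (∀ j, ρ ≤ r j) ∧ ∀ j, r j ≤ θ := by
  rcases isEmpty_or_nonempty (Fin N) with h | h
  · exact ⟨1 / 2, 1 / 2, by norm_num, by norm_num, by norm_num, h.elim, h.elim⟩
  · obtain ⟨a, ha⟩ := Finite.exists_min r
    obtain ⟨b, hb⟩ := Finite.exists_max r
    exact ⟨r a, r b, (hr a).1, (hr b).1, (hr b).2, ha, hb⟩

/-- Under the open set condition the number of cylinder sets of comparable size near a given
one is bounded. -/
theorem exists_card_neighbors_le (hr : ∀ j, r j ∈ Set.Ioo (0 : ℝ) 1)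
    (hsim : ∀ j, IsSimilarity (φ j) (r j)) (hV : V.Nonempty) (hVo : IsOpen V)
    (hFc : IsCompact F) {ρ : ℝ} (hρ : 0 < ρ) :
    ∃ M : ℕ, ∀ (k : List (Fin N)) (T : Finset (List (Fin N))),
      (∀ i ∈ T, ρ * wordRatio r k ≤ wordRatio r i ∧ wordRatio r i ≤ wordRatio r k ∧
        ∃ x ∈ wordMap φ i '' F, ∃ y ∈ wordMap φ k '' F, dist x y ≤ wordRatio r k) →
      ((T : Set (List (Fin N))).Pairwise fun i i' =>
        Disjoint (wordMap φ i '' V) (wordMap φ i' '' V)) → T.card ≤ M := by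
  obtain ⟨v, hv⟩ := hV
  obtain ⟨η, hη, hball⟩ := Metric.isOpen_iff.1 hVo v hv
  obtain ⟨R, hR0, hR⟩ := hFc.isBounded.subset_closedBall_lt 0 v
  obtain ⟨M, hM⟩ := exists_card_le_of_separated (E := EuclideanSpace ℝ (Fin m)) (2 * R + 1)
    (mul_pos hη hρ)
  refine ⟨M, fun k T hT hdisj => hM _ T (fun i => wordMap φ i v) (wordMap φ k v)
    (wordRatio r k) (wordRatio_pos hr k) ?_ ?_⟩
  · intro i hi
    obtain ⟨-, hik, _, ⟨a, ha, rfl⟩, _, ⟨b, hb, rfl⟩, hab⟩ := hT i hi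
    have h1 := isSimilarity_wordMap hsim i v a
    have h2 := isSimilarity_wordMap hsim k b v
    have h3 : dist v a ≤ R := by rw [dist_comm]; exact hR ha
    have h4 : dist b v ≤ R := hR hb
    have h5 := dist_triangle4 (wordMap φ i v) (wordMap φ i a) (wordMap φ k b) (wordMap φ k v)
    have h6 : wordRatio r i * dist v a ≤ wordRatio r k * R :=
      mul_le_mul hik h3 dist_nonneg (wordRatio_pos hr k).le
    have h7 := mul_le_mul_of_nonneg_left h4 (wordRatio_pos hr k).le
    linarith
  · intro i hi j hj hij
    by_contra! hlt
    have hpos := wordRatio_pos hr i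
    obtain ⟨z, hz⟩ := wordMap_surjective (fun j => (hsim j).surjective (hr j).1) i (wordMap φ j v)
    have hzv : z ∈ V := by
      apply hball
      rw [mem_ball, dist_comm]
      rw [← hz, isSimilarity_wordMap hsim i v z] at hlt
      have : wordRatio r i * dist v z < wordRatio r i * η := by nlinarith [(hT i hi).1]
      exact lt_of_mul_lt_mul_left this hpos.le
    exact Set.disjoint_left.1 (hdisj hi hj hij) ⟨z, hzv, rfl⟩ ⟨v, hv, hz.symm⟩

/-- A word `k` with maximally many neighbouring cylinder sets: all cylinder sets close to
`φ_{ak}(F)` lie in the first-level set that contains it. -/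
theorem exists_isolating_word (hr : ∀ j, r j ∈ Set.Ioo (0 : ℝ) 1)
    (hsim : ∀ j, IsSimilarity (φ j) (r j)) (hV : V.Nonempty) (hVo : IsOpen V)
    (hVsub : ∀ j, φ j '' V ⊆ V) (hVd : Pairwise fun i j => Disjoint (φ i '' V) (φ j '' V))
    (hFc : IsCompact F) (hFinv : F = ⋃ j, φ j '' F) :
    ∃ k : List (Fin N), ∀ (j : Fin N) (a : List (Fin N)) (l : Fin N), l ≠ j →
      ∀ x ∈ wordMap φ (j :: a ++ k) '' F, ∀ y ∈ φ l '' F,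
        wordRatio r (j :: a ++ k) < dist x y := by
  obtain ⟨ρ, θ, hρ, hθ0, hθ1, hρr, hrθ⟩ := exists_ratio_bounds hr
  obtain ⟨M, hM⟩ := exists_card_neighbors_le hr hsim hV hVo hFc hρ
  let P : ℕ → Prop := fun n => ∃ (k : List (Fin N)) (T : Finset (List (Fin N))),
      (∀ i ∈ T, ρ * wordRatio r k ≤ wordRatio r i ∧ wordRatio r i ≤ wordRatio r k ∧
        ∃ x ∈ wordMap φ i '' F, ∃ y ∈ wordMap φ k '' F, dist x y ≤ wordRatio r k) ∧
      ((T : Set (List (Fin N))).Pairwise fun i i' =>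
        Disjoint (wordMap φ i '' V) (wordMap φ i' '' V)) ∧ T.card = n
  have hbdd : BddAbove {n | P n} := ⟨M, by rintro n ⟨k, T, h1, h2, rfl⟩; exact hM k T h1 h2⟩
  obtain ⟨k, T, hT, hTd, hcard⟩ : P (sSup {n | P n}) :=
    Nat.sSup_mem ⟨0, show P 0 from ⟨[], ∅, by simp⟩⟩ hbdd
  refine ⟨k, fun j a l hlj x hx y hy => ?_⟩
  by_contra! hle
  have ht1 : wordRatio r (j :: a ++ k) < 1 := by
    rw [List.cons_append, wordRatio_cons]
    have := wordRatio_le_one hr (a ++ k)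
    nlinarith [(hr j).1, (hr j).2]
  have ht0 := wordRatio_pos hr (j :: a ++ k)
  obtain ⟨n, hn⟩ := exists_pow_lt_of_lt_one ht0 hθ1
  obtain ⟨y, hyF, rfl⟩ := hy
  obtain ⟨w, hw, hw1, hw2⟩ :=
    exists_wordRatio_mem_Icc hFinv hρ hρr hrθ n _ ht1 hn.le l y hyF
  have hinj : Function.Injective (wordMap φ (j :: a)) :=
    (isSimilarity_wordMap hsim _).injective (wordRatio_pos hr _)
  have happ : Function.Injective fun i => j :: a ++ i := List.append_right_injective _
  have hdl : ∀ i, Disjoint (wordMap φ (l :: w) '' V) (wordMap φ (j :: a ++ i) '' V) := fun i =>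
    (hVd hlj).mono (wordMap_cons_image_subset hVsub l w) (wordMap_cons_image_subset hVsub j _)
  have hnotin : l :: w ∉ T.map ⟨_, happ⟩ := by
    intro h
    obtain ⟨i, -, hi⟩ := Finset.mem_map.1 h
    simp only [Function.Embedding.coeFn_mk, List.cons_append, List.cons.injEq] at hi
    exact hlj hi.1.symm
  have hsucc : P (sSup {n | P n} + 1) := by
    refine ⟨j :: a ++ k, Finset.cons (l :: w) (T.map ⟨_, happ⟩) hnotin, ?_, ?_,
      by rw [Finset.card_cons, Finset.card_map, hcard]⟩
    · intro i hi
      rcases Finset.mem_cons.1 hi with rfl | hi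
      · exact ⟨hw1, hw2, _, hw, x, hx, by rwa [dist_comm]⟩
      · obtain ⟨i, hiT, rfl⟩ := Finset.mem_map.1 hi
        obtain ⟨h1, h2, x', ⟨b, hb, rfl⟩, y', ⟨c, hc, rfl⟩, h3⟩ := hT i hiT
        have hpos := wordRatio_pos hr (j :: a)
        simp only [Function.Embedding.coeFn_mk]
        rw [wordRatio_append r (j :: a) k, wordRatio_append r (j :: a) i]
        refine ⟨by nlinarith, by nlinarith, _, ⟨b, hb, rfl⟩, _, ⟨c, hc, rfl⟩, ?_⟩
        simp only [wordMap_append φ (j :: a), Function.comp_apply]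
        rw [isSimilarity_wordMap hsim]
        exact mul_le_mul_of_nonneg_left h3 hpos.le
    · rw [Finset.coe_cons, Set.pairwise_insert]
      constructor
      · intro i hi i' hi' hne
        simp only [Finset.coe_map, Function.Embedding.coeFn_mk] at hi hi'
        obtain ⟨i, hi, rfl⟩ := hi
        obtain ⟨i', hi', rfl⟩ := hi'
        have := hTd hi hi' fun h => hne (by rw [h])
        change Disjoint (wordMap φ (j :: a ++ i) '' V) (wordMap φ (j :: a ++ i') '' V)
        rw [wordMap_append, wordMap_append, Set.image_comp, Set.image_comp]
        exact Set.disjoint_image_of_injective hinj this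
      · intro i hi _
        simp only [Finset.coe_map, Function.Embedding.coeFn_mk] at hi
        obtain ⟨i, hi, rfl⟩ := hi
        exact ⟨hdl i, (hdl i).symm⟩
  have := le_csSup hbdd hsucc
  omega

theorem dimension_pos (hN : 2 ≤ N) (hr : ∀ j, r j ∈ Set.Ioo (0 : ℝ) 1) {D : ℝ}
    (hD : ∑ j, r j ^ D = 1) : 0 < D := by
  by_contra! h
  have : ∑ _j : Fin N, (1 : ℝ) ≤ ∑ j, r j ^ D := Finset.sum_le_sum fun j _ =>
    Real.one_le_rpow_of_pos_of_le_one_of_nonpos (hr j).1 (hr j).2.le h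
  rw [hD] at this
  simp only [Finset.sum_const, Finset.card_univ, Fintype.card_fin, nsmul_eq_mul, mul_one] at this
  have h2 : (2 : ℝ) ≤ N := by exact_mod_cast hN
  linarith

theorem wordRatio_ofFn {n : ℕ} (w : Fin n → Fin N) :
    wordRatio r (List.ofFn w) = ∏ i, r (w i) := by
  simp [wordRatio, List.map_ofFn, List.prod_ofFn]

/-- Forbidding one word of a given length lowers the similarity dimension. -/
theorem exists_exponent_of_forbidden_word (hN : 2 ≤ N) (hr : ∀ j, r j ∈ Set.Ioo (0 : ℝ) 1)
    {D : ℝ} (hD : ∑ j, r j ^ D = 1) {n : ℕ} (k : Fin n → Fin N) :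
    ∃ β : ℝ, 0 < β ∧ β < D ∧
      ∑ w ∈ Finset.univ.erase k, wordRatio r (List.ofFn w) ^ β ≤ 1 := by
  have hpos := fun w : Fin n → Fin N => wordRatio_pos hr (List.ofFn w)
  have hsum : ∑ w : Fin n → Fin N, wordRatio r (List.ofFn w) ^ D = 1 := by
    rw [← one_pow n, ← hD, Fintype.sum_pow]
    refine Finset.sum_congr rfl fun w _ => ?_
    rw [wordRatio_ofFn, Real.finsetProd_rpow _ _ fun i _ => (hr _).1.le]
  have hlt : ∑ w ∈ Finset.univ.erase k, wordRatio r (List.ofFn w) ^ D < 1 := by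
    rw [← hsum, ← Finset.add_sum_erase _ _ (Finset.mem_univ k)]
    linarith [Real.rpow_pos_of_pos (hpos k) D]
  have hcont : Continuous fun β : ℝ =>
      ∑ w ∈ Finset.univ.erase k, wordRatio r (List.ofFn w) ^ β :=
    continuous_finsetSum _ fun w _ => Real.continuous_const_rpow (hpos w).ne'
  have h1 : ∀ᶠ β in 𝓝[<] D, ∑ w ∈ Finset.univ.erase k, wordRatio r (List.ofFn w) ^ β < 1 :=
    (hcont.tendsto D).eventually_lt_const hlt |>.filter_mono nhdsWithin_le_nhds
  have h2 : ∀ᶠ β in 𝓝[<] D, 0 < β :=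
    (eventually_gt_nhds (dimension_pos hN hr hD)).filter_mono nhdsWithin_le_nhds
  obtain ⟨β, hβ1, hβ2, hβ3⟩ := (h1.and (h2.and self_mem_nhdsWithin)).exists
  exact ⟨β, hβ2, hβ3, hβ1.le⟩

/-- Separated sets of points of `φ_j(F)` close to the other first-level sets have
cardinality of order strictly smaller than `D`. -/
theorem exists_card_overlap_le (hN : 2 ≤ N) (hr : ∀ j, r j ∈ Set.Ioo (0 : ℝ) 1)
    (hsim : ∀ j, IsSimilarity (φ j) (r j)) (hV : V.Nonempty) (hVo : IsOpen V)
    (hVsub : ∀ j, φ j '' V ⊆ V) (hVd : Pairwise fun i j => Disjoint (φ i '' V) (φ j '' V))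
    (hFc : IsCompact F) (hFinv : F = ⋃ j, φ j '' F) {D : ℝ} (hD : ∑ j, r j ^ D = 1)
    {x₁ : ℝ} (hx₁ : 0 < x₁) :
    ∃ β C : ℝ, 0 < β ∧ β < D ∧ 0 ≤ C ∧ ∀ (j : Fin N) (x : ℝ), x₁ < x →
      ∀ S : Finset (EuclideanSpace ℝ (Fin m)), (S : Set (EuclideanSpace ℝ (Fin m))) ⊆ φ j '' F →
        ((S : Set (EuclideanSpace ℝ (Fin m))).Pairwise fun p q => 2 * x⁻¹ < dist p q) →
        (∀ p ∈ S, ∃ l, l ≠ j ∧ ∃ q ∈ φ l '' F, dist p q ≤ 2 * x⁻¹) →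
        (S.card : ℝ) ≤ C * x ^ β := by
  classical
  obtain ⟨k₀, hk₀⟩ := exists_isolating_word hr hsim hV hVo hVsub hVd hFc hFinv
  set k : List (Fin N) := ⟨0, by omega⟩ :: k₀ with hkdef
  have hk : ∀ (j : Fin N) (a : List (Fin N)) (l : Fin N), l ≠ j →
      ∀ x ∈ wordMap φ (j :: a ++ k) '' F, ∀ y ∈ φ l '' F,
        wordRatio r (j :: a ++ k) < dist x y := by
    intro j a
    have : j :: a ++ k = j :: (a ++ [⟨0, by omega⟩]) ++ k₀ := by simp [hkdef]
    rw [this]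
    exact hk₀ j _
  have hlen : 0 < k.length := by simp [hkdef]
  obtain ⟨β, hβ0, hβD, hβ⟩ := exists_exponent_of_forbidden_word hN hr hD k.get
  obtain ⟨ρ, θ, hρ, hθ0, hθ1, hρr, hrθ⟩ := exists_ratio_bounds hr
  obtain ⟨R, hR0, hR⟩ := hFc.isBounded.subset_closedBall_lt 0 (0 : EuclideanSpace ℝ (Fin m))
  set K : ℝ := 2 / wordRatio r k with hK
  have hkpos := wordRatio_pos hr k
  have hKpos : 0 < K := by positivity
  obtain ⟨C₀, hC₀⟩ := exists_card_le_of_separated (E := EuclideanSpace ℝ (Fin m)) (K * R)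
    (two_pos : (0 : ℝ) < 2)
  set κ : ℝ := ρ ^ k.length with hκ
  have hκpos : 0 < κ := by positivity
  have hwκ : ∀ w : Fin k.length → Fin N, κ ≤ wordRatio r (List.ofFn w) := by
    intro w
    rw [wordRatio_ofFn, hκ]
    simpa using Finset.prod_le_prod (s := Finset.univ) (f := fun _ : Fin k.length => ρ)
      (g := fun i => r (w i)) (fun i _ => hρ.le) (fun i _ => hρr _)
  have hwθ : ∀ w : Fin k.length → Fin N, wordRatio r (List.ofFn w) ≤ θ := by
    intro w
    have hne : List.ofFn w ≠ [] := fun h => hlen.ne' (List.ofFn_eq_nil_iff.1 h)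
    obtain ⟨b, w', hw'⟩ := List.exists_cons_of_ne_nil hne
    rw [hw', wordRatio_cons]
    have := wordRatio_le_one hr w'
    nlinarith [(hr b).1, hrθ b]
  set c : ℝ := min (K * κ) (ρ * x₁) with hc
  have hcpos : 0 < c := by positivity
  set C : ℝ := C₀ / c ^ β with hC
  have hcβ : 0 < c ^ β := Real.rpow_pos_of_pos hcpos _
  have hCnonneg : 0 ≤ C := by positivity
  have key : ∀ (x : ℝ), 0 < x → ∀ (j : Fin N) (n : ℕ) (a : List (Fin N))
      (S : Finset (EuclideanSpace ℝ (Fin m))),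
      c ≤ wordRatio r (j :: a) * x → wordRatio r (j :: a) * x * θ ^ n ≤ K →
      (S : Set (EuclideanSpace ℝ (Fin m))) ⊆ wordMap φ (j :: a) '' F →
      ((S : Set (EuclideanSpace ℝ (Fin m))).Pairwise fun p q => 2 * x⁻¹ < dist p q) →
      (∀ p ∈ S, ∃ l, l ≠ j ∧ ∃ q ∈ φ l '' F, dist p q ≤ 2 * x⁻¹) →
      (S.card : ℝ) ≤ C * (wordRatio r (j :: a) * x) ^ β := by
    intro x hx j n
    have hx' : 0 < x⁻¹ := inv_pos.2 hx
    have base : ∀ (a : List (Fin N)) (S : Finset (EuclideanSpace ℝ (Fin m))),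
        c ≤ wordRatio r (j :: a) * x → wordRatio r (j :: a) * x ≤ K →
        (S : Set (EuclideanSpace ℝ (Fin m))) ⊆ wordMap φ (j :: a) '' F →
        ((S : Set (EuclideanSpace ℝ (Fin m))).Pairwise fun p q => 2 * x⁻¹ < dist p q) →
        (S.card : ℝ) ≤ C * (wordRatio r (j :: a) * x) ^ β := by
      intro a S h1 h2 hS hsep
      have hcard : S.card ≤ C₀ := by
        refine hC₀ _ S id (wordMap φ (j :: a) 0) x⁻¹ hx' ?_ fun p hp q hq hpq =>
          (hsep hp hq hpq).le
        intro p hp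
        obtain ⟨z, hz, rfl⟩ := hS hp
        rw [id, isSimilarity_wordMap hsim]
        have h3 : dist z 0 ≤ R := hR hz
        have h4 : wordRatio r (j :: a) ≤ K * x⁻¹ := by
          rwa [← div_eq_mul_inv, le_div_iff₀ hx]
        calc wordRatio r (j :: a) * dist z 0 ≤ (K * x⁻¹) * R :=
              mul_le_mul h4 h3 dist_nonneg (by positivity)
          _ = K * R * x⁻¹ := by ring
      calc (S.card : ℝ) ≤ C₀ := by exact_mod_cast hcard
        _ = C * c ^ β := by rw [hC, div_mul_cancel₀ _ hcβ.ne']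
        _ ≤ C * (wordRatio r (j :: a) * x) ^ β :=
          mul_le_mul_of_nonneg_left (Real.rpow_le_rpow hcpos.le h1 hβ0.le) hCnonneg
    induction n with
    | zero =>
      intro a S h1 h2 hS hsep _
      exact base a S h1 (by simpa using h2) hS hsep
    | succ n ih =>
      intro a S h1 h2 hS hsep hbad
      by_cases hle : wordRatio r (j :: a) * x ≤ K
      · exact base a S h1 hle hS hsep
      push Not at hle
      have hapos := wordRatio_pos hr (j :: a)
      let G : (Fin k.length → Fin N) → Finset (EuclideanSpace ℝ (Fin m)) := fun w =>
        S.filter fun p => p ∈ wordMap φ (j :: (a ++ List.ofFn w)) '' F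
      have hcover : S ⊆ (Finset.univ.erase k.get).biUnion G := by
        intro p hp
        obtain ⟨z, hz, hzp⟩ := hS hp
        obtain ⟨w, u, hu, huz⟩ := exists_mem_wordMap_image hFinv k.length z hz
        have hmem : p ∈ wordMap φ (j :: a ++ List.ofFn w) '' F :=
          ⟨u, hu, by rw [wordMap_append, Function.comp_apply, huz, hzp]⟩
        refine Finset.mem_biUnion.2 ⟨w, Finset.mem_erase.2 ⟨?_, Finset.mem_univ _⟩,
          Finset.mem_filter.2 ⟨hp, hmem⟩⟩
        rintro rfl
        rw [List.ofFn_get] at hmem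
        obtain ⟨l, hl, q, hq, hpq⟩ := hbad p hp
        have h3 := hk j a l hl p hmem q hq
        rw [wordRatio_append] at h3
        rw [hK, div_lt_iff₀ hkpos] at hle
        have h4 : 2 * x⁻¹ < wordRatio r (j :: a) * wordRatio r k := by
          rw [← div_eq_mul_inv, div_lt_iff₀ hx]
          linarith
        linarith
      have hG : ∀ w, ((G w).card : ℝ) ≤
          C * (wordRatio r (j :: a) * x) ^ β * wordRatio r (List.ofFn w) ^ β := by
        intro w
        have hwpos := wordRatio_pos hr (List.ofFn w)
        have hprod : wordRatio r (j :: (a ++ List.ofFn w)) * x =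
            wordRatio r (j :: a) * x * wordRatio r (List.ofFn w) := by
          rw [← List.cons_append, wordRatio_append]; ring
        rw [mul_assoc, ← Real.mul_rpow (by positivity) hwpos.le, ← hprod]
        have hsub : (G w : Set (EuclideanSpace ℝ (Fin m))) ⊆ S :=
          Finset.coe_subset.2 (Finset.filter_subset _ _)
        refine ih (a ++ List.ofFn w) (G w) ?_ ?_ (fun p hp => (Finset.mem_filter.1 hp).2)
          (hsep.mono hsub) (fun p hp => hbad p (hsub hp))
        · rw [hprod]
          exact (min_le_left _ _).trans (mul_le_mul hle.le (hwκ w) hκpos.le (by positivity))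
        · rw [hprod]
          refine le_trans ?_ h2
          rw [pow_succ', ← mul_assoc]
          exact mul_le_mul_of_nonneg_right
            (mul_le_mul_of_nonneg_left (hwθ w) (by positivity)) (by positivity)
      calc (S.card : ℝ) ≤ ∑ w ∈ Finset.univ.erase k.get, ((G w).card : ℝ) := by
            exact_mod_cast (Finset.card_le_card hcover).trans Finset.card_biUnion_le
        _ ≤ ∑ w ∈ Finset.univ.erase k.get,
            C * (wordRatio r (j :: a) * x) ^ β * wordRatio r (List.ofFn w) ^ β :=
          Finset.sum_le_sum fun w _ => hG w
        _ = C * (wordRatio r (j :: a) * x) ^ β *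
            ∑ w ∈ Finset.univ.erase k.get, wordRatio r (List.ofFn w) ^ β := by
          rw [Finset.mul_sum]
        _ ≤ C * (wordRatio r (j :: a) * x) ^ β := mul_le_of_le_one_right (by positivity) hβ
  refine ⟨β, C, hβ0, hβD, hCnonneg, fun j x hx S hS hsep hbad => ?_⟩
  have hx0 : 0 < x := hx₁.trans hx
  have hrj : wordRatio r [j] = r j := by simp [wordRatio]
  obtain ⟨n, hn⟩ := exists_pow_lt_of_lt_one (div_pos hKpos hx0) hθ1
  have hθn : 0 < θ ^ n := by positivity
  refine (key x hx0 j n [] S ?_ ?_ (by simpa [wordMap] using hS) hsep hbad).trans ?_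
  · rw [hrj]
    exact (min_le_right _ _).trans (mul_le_mul (hρr j) hx.le hx₁.le (hr j).1.le)
  · rw [hrj]
    rw [lt_div_iff₀ hx0] at hn
    nlinarith [(hr j).2, mul_pos hθn hx0]
  · rw [hrj]
    exact mul_le_mul_of_nonneg_left (Real.rpow_le_rpow (mul_pos (hr j).1 hx0).le
      (mul_le_of_le_one_left hx0.le (hr j).2.le) hβ0.le) hCnonneg

theorem boxCount_le_sum (hr : ∀ j, r j ∈ Set.Ioo (0 : ℝ) 1)
    (hsim : ∀ j, IsSimilarity (φ j) (r j)) (hFc : IsCompact F) (hFinv : F = ⋃ j, φ j '' F)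
    {x : ℝ} (hx : 0 < x) : boxCount F x ≤ ∑ j, boxCount F (r j * x) := by
  classical
  obtain ⟨S, hS, hsep, hcard⟩ := exists_card_eq_boxCount hFc hx
  let G : Fin N → Finset (EuclideanSpace ℝ (Fin m)) := fun j => S.filter fun p => p ∈ φ j '' F
  have hcover : S ⊆ Finset.univ.biUnion G := by
    intro p hp
    have := hS hp
    rw [hFinv] at this
    obtain ⟨j, hj⟩ := Set.mem_iUnion.1 this
    exact Finset.mem_biUnion.2 ⟨j, Finset.mem_univ _, Finset.mem_filter.2 ⟨hp, hj⟩⟩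
  rw [← hcard]
  refine ((Finset.card_le_card hcover).trans Finset.card_biUnion_le).trans
    (Finset.sum_le_sum fun j _ => ?_)
  have hinj := (hsim j).injective (hr j).1
  obtain ⟨T, hT, hTG⟩ := Finset.subset_set_image_iff.1
    (show (G j : Set (EuclideanSpace ℝ (Fin m))) ⊆ φ j '' F from
      fun p hp => (Finset.mem_filter.1 hp).2)
  rw [← hTG, Finset.card_image_of_injective _ hinj]
  refine card_le_boxCount hFc (mul_pos (hr j).1 hx) hT fun p hp q hq hpq => ?_
  have hmem : ∀ p ∈ T, φ j p ∈ (S : Set (EuclideanSpace ℝ (Fin m))) := fun p hp =>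
    Finset.filter_subset _ _ (hTG ▸ Finset.mem_image_of_mem _ hp : φ j p ∈ G j)
  have : 2 * x⁻¹ < dist (φ j p) (φ j q) := hsep (hmem p hp) (hmem q hq) (hinj.ne hpq)
  rw [hsim j, ← div_lt_iff₀' (hr j).1] at this
  change 2 * (r j * x)⁻¹ < dist p q
  rwa [mul_inv_rev, ← mul_assoc, ← div_eq_mul_inv]

theorem sum_boxCount_le (hr : ∀ j, r j ∈ Set.Ioo (0 : ℝ) 1)
    (hsim : ∀ j, IsSimilarity (φ j) (r j)) (hFc : IsCompact F) (hFinv : F = ⋃ j, φ j '' F)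
    {x B : ℝ} (hx : 0 < x)
    (hB : ∀ (j : Fin N) (S : Finset (EuclideanSpace ℝ (Fin m))),
      (S : Set (EuclideanSpace ℝ (Fin m))) ⊆ φ j '' F →
      ((S : Set (EuclideanSpace ℝ (Fin m))).Pairwise fun p q => 2 * x⁻¹ < dist p q) →
      (∀ p ∈ S, ∃ l, l ≠ j ∧ ∃ q ∈ φ l '' F, dist p q ≤ 2 * x⁻¹) → (S.card : ℝ) ≤ B) :
    ∑ j, (boxCount F (r j * x) : ℝ) ≤ boxCount F x + N * B := by
  classical
  have hx' : 0 < x⁻¹ := inv_pos.2 hx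
  have hex : ∀ j, ∃ S : Finset (EuclideanSpace ℝ (Fin m)),
      (S : Set (EuclideanSpace ℝ (Fin m))) ⊆ φ j '' F ∧
      ((S : Set (EuclideanSpace ℝ (Fin m))).Pairwise fun p q => 2 * x⁻¹ < dist p q) ∧
      S.card = boxCount F (r j * x) := by
    intro j
    obtain ⟨T, hT, hsep, hcard⟩ := exists_card_eq_boxCount hFc (mul_pos (hr j).1 hx)
    refine ⟨T.image (φ j), by rw [Finset.coe_image]; exact Set.image_mono hT, ?_, by
      rw [Finset.card_image_of_injective _ ((hsim j).injective (hr j).1), hcard]⟩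
    rw [Finset.coe_image]
    rintro _ ⟨p, hp, rfl⟩ _ ⟨q, hq, rfl⟩ hpq
    have := hsep hp hq fun h => hpq (by rw [h])
    rw [hsim j, ← div_lt_iff₀' (hr j).1]
    rwa [mul_inv_rev, ← mul_assoc, ← div_eq_mul_inv] at this
  choose S hS hsep hcard using hex
  let bad : Fin N → EuclideanSpace ℝ (Fin m) → Prop := fun j p =>
    ∃ l, l ≠ j ∧ ∃ q ∈ φ l '' F, dist p q ≤ 2 * x⁻¹
  let G : Fin N → Finset (EuclideanSpace ℝ (Fin m)) := fun j => (S j).filter fun p => ¬ bad j p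
  have hfar : ∀ i j, i ≠ j → ∀ p ∈ G i, ∀ q ∈ G j, 2 * x⁻¹ < dist p q := by
    intro i j hij p hp q hq
    by_contra! hle
    exact (Finset.mem_filter.1 hp).2
      ⟨j, hij.symm, q, hS j (Finset.mem_filter.1 hq).1, hle⟩
  have hdisj : ((Finset.univ : Finset (Fin N)) : Set (Fin N)).PairwiseDisjoint G := by
    intro i _ j _ hij
    refine Finset.disjoint_left.2 fun p hp hq => ?_
    have := hfar i j hij p hp p hq
    rw [dist_self] at this
    linarith
  have hgood : (Finset.univ.biUnion G).card ≤ boxCount F x := by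
    refine card_le_boxCount hFc hx ?_ ?_
    · intro p hp
      obtain ⟨j, -, hj⟩ := Finset.mem_biUnion.1 (Finset.mem_coe.1 hp)
      rw [hFinv]
      exact Set.mem_iUnion.2 ⟨j, hS j (Finset.mem_filter.1 hj).1⟩
    · intro p hp q hq hpq
      obtain ⟨i, -, hi⟩ := Finset.mem_biUnion.1 (Finset.mem_coe.1 hp)
      obtain ⟨j, -, hj⟩ := Finset.mem_biUnion.1 (Finset.mem_coe.1 hq)
      by_cases hij : i = j
      · subst hij
        exact hsep i (Finset.mem_filter.1 hi).1 (Finset.mem_filter.1 hj).1 hpq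
      · exact hfar i j hij p hi q hj
  rw [Finset.card_biUnion hdisj] at hgood
  have hgood' : ∑ j, ((G j).card : ℝ) ≤ boxCount F x := by exact_mod_cast hgood
  have hj : ∀ j, (boxCount F (r j * x) : ℝ) ≤ (G j).card + B := by
    intro j
    have h1 := Finset.card_filter_add_card_filter_not (s := S j) (bad j)
    have h2 : (((S j).filter (bad j)).card : ℝ) ≤ B := by
      have hsub : (((S j).filter (bad j) : Finset _) : Set (EuclideanSpace ℝ (Fin m))) ⊆ S j :=
        Finset.coe_subset.2 (Finset.filter_subset _ _)
      exact hB j _ (hsub.trans (hS j)) ((hsep j).mono hsub)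
        fun p hp => (Finset.mem_filter.1 hp).2
    rw [← hcard j, ← h1]
    push_cast
    linarith
  calc ∑ j, (boxCount F (r j * x) : ℝ) ≤ ∑ j, ((G j).card + B) :=
        Finset.sum_le_sum fun j _ => hj j
    _ = ∑ j, ((G j).card : ℝ) + N * B := by simp [Finset.sum_add_distrib]
    _ ≤ boxCount F x + N * B := by linarith

end SelfSimilar

/-- For a self-similar system on `ℝ^m` satisfying the open set condition, with infinite
attractor `F`, similarity dimension `D`, `x₁ = sup {x > 0 : N_B(F,x) = 1}`, and renewal
error `L(x) = N_B(F,x) - ∑_j N_B(F, r_j x)`, there exists `ε > 0` such that for every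
`s ∈ ℂ` with `Re s > D - ε` the integral `E(s) = s ∫_{x₁}^∞ L(x) x^{-s-1} dx` converges
absolutely. -/
theorem stmt17 {m N : ℕ} (hN : 2 ≤ N)
    (φ : Fin N → EuclideanSpace ℝ (Fin m) → EuclideanSpace ℝ (Fin m))
    (r : Fin N → ℝ) (hr : ∀ j, r j ∈ Set.Ioo (0 : ℝ) 1)
    (hsim : ∀ j, IsSimilarity (φ j) (r j))
    (hOSC : ∃ V : Set (EuclideanSpace ℝ (Fin m)), V.Nonempty ∧ IsOpen V ∧
      (∀ j, φ j '' V ⊆ V) ∧ Pairwise fun i j => Disjoint (φ i '' V) (φ j '' V))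
    (F : Set (EuclideanSpace ℝ (Fin m)))
    (hFne : F.Nonempty) (hFc : IsCompact F) (hFinv : F = ⋃ j, φ j '' F)
    (hFinfinite : F.Infinite)
    (D : ℝ) (hD : ∑ j, r j ^ D = 1)
    (x₁ : ℝ) (hx₁ : x₁ = sSup {x : ℝ | 0 < x ∧ boxCount F x = 1})
    (L : ℝ → ℝ) (hL : ∀ x, L x = (boxCount F x : ℝ) - ∑ j, (boxCount F (r j * x) : ℝ)) :
    ∃ ε : ℝ, 0 < ε ∧ ∀ s : ℂ, D - ε < s.re →
      MeasureTheory.IntegrableOn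
        (fun x : ℝ => (L x : ℂ) * (x : ℂ) ^ (-s - 1)) (Set.Ioi x₁) := by
  obtain ⟨V, hV, hVo, hVsub, hVd⟩ := hOSC
  have hx₁pos : 0 < x₁ := hx₁ ▸ sSup_boxCount_eq_one_pos hFc hFinfinite.nontrivial
  obtain ⟨β, C, -, hβD, hC, hbound⟩ := exists_card_overlap_le hN hr hsim hV hVo hVsub hVd hFc
    hFinv hD hx₁pos
  refine ⟨D - β, by linarith, fun s hs => ?_⟩
  rw [sub_sub_cancel] at hs
  have hLbound : ∀ x ∈ Set.Ioi x₁, |L x| ≤ N * C * x ^ β := by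
    intro x hx
    have hx0 : 0 < x := hx₁pos.trans hx
    have h1 : (boxCount F x : ℝ) ≤ ∑ j, (boxCount F (r j * x) : ℝ) := by
      exact_mod_cast boxCount_le_sum hr hsim hFc hFinv hx0
    have h2 := sum_boxCount_le hr hsim hFc hFinv hx0 (B := C * x ^ β)
      fun j S => hbound j x hx S
    rw [hL, abs_sub_comm, abs_of_nonneg (by linarith)]
    linarith
  have hmeas : ∀ a : ℝ, 0 < a →
      AEMeasurable (fun x => (boxCount F (a * x) : ℝ)) (volume.restrict (Set.Ioi x₁)) := by
    intro a ha
    refine aemeasurable_restrict_of_monotoneOn measurableSet_Ioi fun x hx y hy hxy => ?_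
    exact_mod_cast boxCount_monotoneOn hFc (mul_pos ha (hx₁pos.trans hx))
      (mul_pos ha (hx₁pos.trans hy)) (mul_le_mul_of_nonneg_left hxy ha.le)
  have hLmeas : AEMeasurable L (volume.restrict (Set.Ioi x₁)) := by
    have hLeq : L = fun x => (boxCount F (1 * x) : ℝ) - ∑ j, (boxCount F (r j * x) : ℝ) := by
      funext x; rw [hL, one_mul]
    rw [hLeq]
    exact (hmeas 1 one_pos).sub
      (Finset.aemeasurable_fun_sum _ fun j _ => hmeas (r j) (hr j).1)
  have hint : IntegrableOn (fun x : ℝ => N * C * x ^ (β - s.re - 1)) (Set.Ioi x₁) :=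
    (integrableOn_Ioi_rpow_of_lt (by linarith) hx₁pos).const_mul _
  refine Integrable.mono' hint ?_ ?_
  · refine ((Complex.measurable_ofReal.comp_aemeasurable hLmeas).mul ?_).aestronglyMeasurable
    exact (Complex.measurable_ofReal.pow_const _).aemeasurable
  · refine (ae_restrict_iff' measurableSet_Ioi).2 (Eventually.of_forall fun x hx => ?_)
    have hx0 : 0 < x := hx₁pos.trans hx
    rw [norm_mul, Complex.norm_real, Real.norm_eq_abs,
      Complex.norm_cpow_eq_rpow_re_of_pos hx0]
    have hexp : x ^ (β - s.re - 1) = x ^ β * x ^ (-s - 1).re := by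
      rw [← Real.rpow_add hx0]
      congr 1
      simp only [Complex.sub_re, Complex.neg_re, Complex.one_re]
      ring
    rw [hexp, ← mul_assoc]
    exact mul_le_mul_of_nonneg_right (hLbound x hx) (Real.rpow_nonneg hx0.le _)
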